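/- arXiv:1908.06879 — 3 statements merged into one kernel-verified Lean document; each statement's English description precedes it below -/
import Mathlib

section
/- Let C be a locally presentable category with a cofibrantly generated weak factorization system (L, R) such that ∅ → X lies in L for every object X, equipped with an exact cylinder I. Let S ⊆ L be a small set of morphisms and M a small generating set for L (i.e., L = llp(rlp(M))). Define Λ^0 = S ∪ { ∂1 ⊠ i : i ∈ M }, Λ^{n+1} = { ∂I ⊠ i : i ∈ Λ^n }, and Λ = ⋃_{n ∈ ℕ} Λ^n. Then llp(rlp(Λ)) is a class of right I-anodyne extensions, and it is the smallest class of right I-anodyne extensions containing S (every class of right I-anodyne extensions containing S contains llp(rlp(Λ))). -/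
set_option linter.unusedSectionVars false

open CategoryTheory CategoryTheory.Limits

universe v u

namespace Paper

variable {C : Type u} [Category.{v} C]

/-- The class of morphisms having the left lifting property against every morphism in `T`. -/
def llp (T : MorphismProperty C) : MorphismProperty C :=
  fun _ _ f => ∀ ⦃X Y : C⦄ (g : X ⟶ Y), T g → HasLiftingProperty f g

/-- The class of morphisms having the right lifting property against every morphism in `T`. -/
def rlp (T : MorphismProperty C) : MorphismProperty C :=
  fun _ _ g => ∀ ⦃A B : C⦄ (f : A ⟶ B), T f → HasLiftingProperty f g

/-- The morphism property associated to a set of arrows. -/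
def ofArrows (S : Set (Arrow C)) : MorphismProperty C :=
  fun _ _ f => Arrow.mk f ∈ S

/-- A (possibly large) category `J` is `κ`-filtered if every diagram in `J` indexed by a
small category of size `< κ` admits a cocone. -/
def IsCardinalFiltered (J : Cat.{v, v}) (κ : Cardinal.{v}) : Prop :=
  ∀ K : Cat.{v, v}, Cardinal.mk (Arrow K) < κ → ∀ F : K ⥤ J, Nonempty (Cocone F)

/-- An object `X` is `κ`-presentable if `Hom(X, -)` preserves colimits of `κ`-filtered
diagrams. -/
def IsPresentableObj (κ : Cardinal.{v}) (X : C) : Prop :=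
  ∀ J : Cat.{v, v}, IsCardinalFiltered J κ →
    PreservesColimitsOfShape J (coyoneda.obj (Opposite.op X))

/-- A category is locally presentable if it is cocomplete and there is a regular cardinal `κ`
and a small family of `κ`-presentable objects such that every object is a `κ`-filtered colimit
of objects of the family. -/
class LocallyPresentable (C : Type u) [Category.{v} C] extends HasColimits C : Prop where
  exists_presentable_generator :
    ∃ κ : Cardinal.{v}, κ.IsRegular ∧
      ∃ (ι : Type v) (G : ι → C), (∀ i, IsPresentableObj κ (G i)) ∧
        ∀ X : C, ∃ (J : Cat.{v, v}) (F : J ⥤ C) (c : Cocone F),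
          IsCardinalFiltered J κ ∧ Nonempty (IsColimit c) ∧
          (∀ j : J, ∃ i, Nonempty (F.obj j ≅ G i)) ∧ Nonempty (c.pt ≅ X)

/-- `(L, R)` is a cofibrantly generated weak factorization system such that every morphism
from the initial object is in `L`. -/
structure IsCofGenWFS [HasColimits C] (L R : MorphismProperty C) : Prop where
  exists_generating_set : ∃ S : Set (Arrow C), Small.{v} S ∧ L = llp (rlp (ofArrows S))
  rlp_eq : R = rlp L
  factorization : ∀ ⦃X Y : C⦄ (f : X ⟶ Y),
    ∃ (Z : C) (i : X ⟶ Z) (p : Z ⟶ Y), L i ∧ R p ∧ i ≫ p = f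
  initial_mem : ∀ X : C, L (initial.to X)

/-- A functorial cylinder on `C`. -/
structure Cylinder (C : Type u) [Category.{v} C] where
  I : C ⥤ C
  d0 : 𝟭 C ⟶ I
  d1 : 𝟭 C ⟶ I
  σ : I ⟶ 𝟭 C
  d0_σ : ∀ X : C, d0.app X ≫ σ.app X = 𝟙 X
  d1_σ : ∀ X : C, d1.app X ≫ σ.app X = 𝟙 X

namespace Cylinder

variable (E : Cylinder C)

lemma d0_naturality' {K M : C} (f : K ⟶ M) :
    f ≫ E.d0.app M = E.d0.app K ≫ E.I.map f := by
  simpa using E.d0.naturality f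

lemma d1_naturality' {K M : C} (f : K ⟶ M) :
    f ≫ E.d1.app M = E.d1.app K ≫ E.I.map f := by
  simpa using E.d1.naturality f

variable [HasColimits C]

/-- The canonical map `X ⊔ X ⟶ I(X)`. -/
noncomputable def ι (X : C) : X ⨿ X ⟶ E.I.obj X :=
  coprod.desc (E.d0.app X) (E.d1.app X)

lemma ι_naturality {K M : C} (f : K ⟶ M) :
    coprod.map f f ≫ E.ι M = E.ι K ≫ E.I.map f := by
  have h0 := E.d0.naturality f
  have h1 := E.d1.naturality f
  simp only [Functor.id_map] at h0 h1
  apply coprod.hom_ext <;> simp [ι, h0, h1]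

/-- The pushout-corner map `∂I ⊠ f : (M ⊔ M) ⊔_{K ⊔ K} I(K) ⟶ I(M)`. -/
noncomputable def boundaryBox {K M : C} (f : K ⟶ M) :
    pushout (coprod.map f f) (E.ι K) ⟶ E.I.obj M :=
  pushout.desc (E.ι M) (E.I.map f) (E.ι_naturality f)

/-- The pushout-corner map `∂0 ⊠ f : M ⊔_K I(K) ⟶ I(M)`. -/
noncomputable def box0 {K M : C} (f : K ⟶ M) :
    pushout f (E.d0.app K) ⟶ E.I.obj M :=
  pushout.desc (E.d0.app M) (E.I.map f) (E.d0_naturality' f)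

/-- The pushout-corner map `∂1 ⊠ f : M ⊔_K I(K) ⟶ I(M)`. -/
noncomputable def box1 {K M : C} (f : K ⟶ M) :
    pushout f (E.d1.app K) ⟶ E.I.obj M :=
  pushout.desc (E.d1.app M) (E.I.map f) (E.d1_naturality' f)

end Cylinder

/-- A cylinder is exact with respect to the class `L` if it preserves small colimits,
the maps `X ⊔ X ⟶ I(X)` are in `L`, and the pushout-corner maps of morphisms of `L` are
again in `L`. -/
structure IsExactCylinder [HasColimits C] (E : Cylinder C) (L : MorphismProperty C) : Prop where
  preservesColimits : PreservesColimits E.I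
  ι_mem : ∀ X : C, L (E.ι X)
  boundaryBox_mem : ∀ ⦃K M : C⦄ (f : K ⟶ M), L f → L (E.boundaryBox f)
  box0_mem : ∀ ⦃K M : C⦄ (f : K ⟶ M), L f → L (E.box0 f)
  box1_mem : ∀ ⦃K M : C⦄ (f : K ⟶ M), L f → L (E.box1 f)

/-- `An` is a class of right `I`-anodyne extensions. -/
structure IsRightAnodyneClass [HasColimits C] (E : Cylinder C) (L : MorphismProperty C)
    (An : MorphismProperty C) : Prop where
  le : An ≤ L
  exists_generating_set : ∃ Λ : Set (Arrow C), Small.{v} Λ ∧ ofArrows Λ ≤ L ∧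
    An = llp (rlp (ofArrows Λ))
  box1_mem : ∀ ⦃K M : C⦄ (f : K ⟶ M), L f → An (E.box1 f)
  boundaryBox_mem : ∀ ⦃K M : C⦄ (f : K ⟶ M), An f → An (E.boundaryBox f)

/-- `An` is a class of left `I`-anodyne extensions. -/
structure IsLeftAnodyneClass [HasColimits C] (E : Cylinder C) (L : MorphismProperty C)
    (An : MorphismProperty C) : Prop where
  le : An ≤ L
  exists_generating_set : ∃ Λ : Set (Arrow C), Small.{v} Λ ∧ ofArrows Λ ≤ L ∧
    An = llp (rlp (ofArrows Λ))
  box0_mem : ∀ ⦃K M : C⦄ (f : K ⟶ M), L f → An (E.box0 f)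
  boundaryBox_mem : ∀ ⦃K M : C⦄ (f : K ⟶ M), An f → An (E.boundaryBox f)

/-- A morphism is an `An`-fibration if it has the right lifting property against all
morphisms of `An`. -/
def IsFib (An : MorphismProperty C) {X Y : C} (p : X ⟶ Y) : Prop :=
  ∀ ⦃A B : C⦄ (f : A ⟶ B), An f → HasLiftingProperty f p

/-- An object `W` is `An`-fibrant if the map `W ⟶ *` has the right lifting property against
all morphisms of `An`, i.e. every morphism to `W` extends along every morphism of `An`. -/
def IsFibrantObj (An : MorphismProperty C) (W : C) : Prop :=
  ∀ ⦃A B : C⦄ (f : A ⟶ B), An f → ∀ a : A ⟶ W, ∃ b : B ⟶ W, f ≫ b = a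

namespace Cylinder

variable (E : Cylinder C)

/-- An `I`-homotopy from `f` to `g`. -/
def Homotopy {X Y : C} (f g : X ⟶ Y) : Prop :=
  ∃ h : E.I.obj X ⟶ Y, E.d0.app X ≫ h = f ∧ E.d1.app X ≫ h = g

/-- `[X, Y]_I`, the quotient of `Hom(X, Y)` by the equivalence relation generated by
`I`-homotopy. -/
def HoHom (X Y : C) : Type v :=
  Quot (fun f g : X ⟶ Y => E.Homotopy f g)

/-- Precomposition `f^* : [B, W]_I ⟶ [A, W]_I`. -/
def precompQ {A B : C} (f : A ⟶ B) (W : C) : E.HoHom B W → E.HoHom A W :=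
  Quot.lift (fun g => Quot.mk _ (f ≫ g)) (by
    rintro g g' ⟨h, h0, h1⟩
    apply Quot.sound
    refine ⟨E.I.map f ≫ h, ?_, ?_⟩
    · rw [← Category.assoc, ← E.d0_naturality' f, Category.assoc, h0]
    · rw [← Category.assoc, ← E.d1_naturality' f, Category.assoc, h1])

end Cylinder

/-- `f` is a weak equivalence if it induces bijections `[B, W]_I ≅ [A, W]_I` for all
fibrant `W`. -/
def IsWeakEq (E : Cylinder C) (An : MorphismProperty C) {A B : C} (f : A ⟶ B) : Prop :=
  ∀ W : C, IsFibrantObj An W → Function.Bijective (E.precompQ f W)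

/-- `f` is a retract of `f'`. -/
def IsRetractOf {X Y X' Y' : C} (f : X ⟶ Y) (f' : X' ⟶ Y') : Prop :=
  ∃ (i : X ⟶ X') (r : X' ⟶ X) (j : Y ⟶ Y') (s : Y' ⟶ Y),
    i ≫ r = 𝟙 X ∧ j ≫ s = 𝟙 Y ∧ i ≫ f' = f ≫ j ∧ f' ≫ s = r ≫ f

/-- A model structure on a category: the classes of weak equivalences, cofibrations and
fibrations, subject to the two-out-of-three, retract, lifting and factorization axioms. -/
structure ModelStructure (C : Type u) [Category.{v} C] where
  weq : MorphismProperty C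
  cof : MorphismProperty C
  fib : MorphismProperty C
  weq_id : ∀ X : C, weq (𝟙 X)
  weq_comp : ∀ ⦃X Y Z : C⦄ (f : X ⟶ Y) (g : Y ⟶ Z), weq f → weq g → weq (f ≫ g)
  weq_cancel_left : ∀ ⦃X Y Z : C⦄ (f : X ⟶ Y) (g : Y ⟶ Z), weq f → weq (f ≫ g) → weq g
  weq_cancel_right : ∀ ⦃X Y Z : C⦄ (f : X ⟶ Y) (g : Y ⟶ Z), weq g → weq (f ≫ g) → weq f
  weq_retract : ∀ ⦃X Y X' Y' : C⦄ (f : X ⟶ Y) (f' : X' ⟶ Y'),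
    IsRetractOf f f' → weq f' → weq f
  cof_retract : ∀ ⦃X Y X' Y' : C⦄ (f : X ⟶ Y) (f' : X' ⟶ Y'),
    IsRetractOf f f' → cof f' → cof f
  fib_retract : ∀ ⦃X Y X' Y' : C⦄ (f : X ⟶ Y) (f' : X' ⟶ Y'),
    IsRetractOf f f' → fib f' → fib f
  lift_trivCof_fib : ∀ ⦃A B X Y : C⦄ (i : A ⟶ B) (p : X ⟶ Y),
    cof i → weq i → fib p → HasLiftingProperty i p
  lift_cof_trivFib : ∀ ⦃A B X Y : C⦄ (i : A ⟶ B) (p : X ⟶ Y),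
    cof i → fib p → weq p → HasLiftingProperty i p
  fact_cof_trivFib : ∀ ⦃X Y : C⦄ (f : X ⟶ Y),
    ∃ (Z : C) (i : X ⟶ Z) (p : Z ⟶ Y), cof i ∧ fib p ∧ weq p ∧ i ≫ p = f
  fact_trivCof_fib : ∀ ⦃X Y : C⦄ (f : X ⟶ Y),
    ∃ (Z : C) (i : X ⟶ Z) (p : Z ⟶ Y), cof i ∧ weq i ∧ fib p ∧ i ≫ p = f

/-- An object `W` is fibrant for a model structure if every morphism to `W` extends along
every trivial cofibration, i.e. `W ⟶ *` has the right lifting property against trivial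
cofibrations. -/
def ModelStructure.Fibrant (M : ModelStructure C) (W : C) : Prop :=
  ∀ ⦃A B : C⦄ (i : A ⟶ B), M.cof i → M.weq i → ∀ a : A ⟶ W, ∃ b : B ⟶ W, i ≫ b = a


/-- The set of arrows `∂1 ⊠ f` for `f` running through a set of arrows. -/
def box1Set [HasColimits C] (E : Cylinder C) (T : Set (Arrow C)) : Set (Arrow C) :=
  { a | ∃ (K M : C) (f : K ⟶ M), Arrow.mk f ∈ T ∧ a = Arrow.mk (E.box1 f) }

/-- The set of arrows `∂I ⊠ f` for `f` running through a set of arrows. -/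
def boundaryBoxSet [HasColimits C] (E : Cylinder C) (T : Set (Arrow C)) : Set (Arrow C) :=
  { a | ∃ (K M : C) (f : K ⟶ M), Arrow.mk f ∈ T ∧ a = Arrow.mk (E.boundaryBox f) }

/-- `Λ⁰ = S ∪ { ∂1 ⊠ i | i ∈ G }`, `Λ^{n+1} = { ∂I ⊠ i | i ∈ Λⁿ }`. -/
def lambdaSeq [HasColimits C] (E : Cylinder C) (S G : Set (Arrow C)) : ℕ → Set (Arrow C)
  | 0 => S ∪ box1Set E G
  | n + 1 => boundaryBoxSet E (lambdaSeq E S G n)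

section AdjointFunctor

/-- A colimit-preserving functor out of a locally presentable category is a left adjoint. -/
theorem isLeftAdjoint_of_preservesColimits [LocallyPresentable C] {D : Type*} [Category.{v} D]
    (F : C ⥤ D) [PreservesColimits F] : F.IsLeftAdjoint := by
  obtain ⟨_, -, ι, G, -, hG⟩ := LocallyPresentable.exists_presentable_generator (C := C)
  have weaklyTerminal : ∀ Y : D, ∃ (W : C) (w : F.obj W ⟶ Y), ∀ (X : C) (h : F.obj X ⟶ Y),
      ∃ g : X ⟶ W, F.map g ≫ w = h := by
    intro Y
    let obj : (Σ i, F.obj (G i) ⟶ Y) → CostructuredArrow F Y := fun a => CostructuredArrow.mk a.2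
    let Q : InducedCategory (CostructuredArrow F Y) obj ⥤ CostructuredArrow F Y :=
      inducedFunctor obj
    refine ⟨(colimit Q).left, (colimit Q).hom, fun X h => ?_⟩
    obtain ⟨J, K, c, -, ⟨hc⟩, hK, ⟨e⟩⟩ := hG X
    choose i α using hK
    let α' : ∀ j, K.obj j ≅ G (i j) := fun j => (α j).some
    let a : ∀ j : J, InducedCategory (CostructuredArrow F Y) obj :=
      fun j => ⟨i j, F.map ((α' j).inv ≫ c.ι.app j ≫ e.hom) ≫ h⟩
    let t : ∀ {j j' : J} (φ : j ⟶ j'), Q.obj (a j) ⟶ Q.obj (a j') := fun {j j'} φ =>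
      CostructuredArrow.homMk ((α' j).inv ≫ K.map φ ≫ (α' j').hom) (by
        change F.map _ ≫ F.map _ ≫ h = F.map _ ≫ h
        rw [← F.map_comp_assoc]
        simp)
    have ht : ∀ {j j' : J} (φ : j ⟶ j'),
        (t φ).left ≫ (colimit.ι Q (a j')).left = (colimit.ι Q (a j)).left := fun {j j'} φ => by
      rw [← CostructuredArrow.comp_left]
      exact congrArg _ (colimit.w Q (InducedCategory.homMk (t φ) : a j ⟶ a j'))
    let d : Cocone K :=
      { pt := (colimit Q).left
        ι :=
          { app := fun j => (α' j).hom ≫ (colimit.ι Q (a j)).left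
            naturality := fun j j' φ => by
              have := ht φ
              simp only [t, CostructuredArrow.homMk_left, Category.assoc] at this
              simp [← this] } }
    refine ⟨e.inv ≫ hc.desc d, ?_⟩
    rw [← cancel_epi (F.map e.hom)]
    refine (isColimitOfPreserves F hc).hom_ext fun j => ?_
    have hw := CostructuredArrow.w (colimit.ι Q (a j))
    change F.map _ ≫ _ = F.map ((α' j).inv ≫ c.ι.app j ≫ e.hom) ≫ h at hw
    trans F.map ((α' j).hom ≫ (colimit.ι Q (a j)).left) ≫ (colimit Q).hom
    · rw [Functor.mapCocone_ι_app, ← F.map_comp_assoc, ← F.map_comp_assoc]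
      simp [d]
    · rw [F.map_comp, Category.assoc, hw, ← F.map_comp_assoc]
      simp
  have : PreservesLimits F.op := preservesLimits_op F
  have : F.op.IsRightAdjoint := by
    refine isRightAdjoint_of_preservesLimits_of_solutionSetCondition F.op fun A => ?_
    obtain ⟨W, w, hw⟩ := weaklyTerminal A.unop
    refine ⟨PUnit, fun _ => .op W, fun _ => w.op, fun X h => ⟨⟨⟩, ?_⟩⟩
    obtain ⟨g, hg⟩ := hw X.unop h.unop
    exact ⟨g.op, Quiver.Hom.unop_inj hg⟩
  exact ⟨_, ⟨(Adjunction.ofIsRightAdjoint F.op).unop⟩⟩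

theorem LocallyPresentable.hasLimits [LocallyPresentable C] : HasLimits C where
  has_limits_of_shape _ _ :=
    hasLimitsOfShape_iff_isLeftAdjoint_const.2 (isLeftAdjoint_of_preservesColimits _)

end AdjointFunctor

section Corner

variable {D : Type*} [Category* D] {F H : C ⥤ D} {F' H' : D ⥤ C}

/-- The transformation of right adjoints corresponding to a transformation of left adjoints. -/
def mate (adj₁ : F ⊣ F') (adj₂ : H ⊣ H') (τ : F ⟶ H) (X : D) : H'.obj X ⟶ F'.obj X :=
  adj₁.homEquiv _ _ (τ.app _ ≫ adj₂.counit.app X)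

lemma homEquiv_comp_mate (adj₁ : F ⊣ F') (adj₂ : H ⊣ H') (τ : F ⟶ H) {K : C} {X : D}
    (b : H.obj K ⟶ X) :
    adj₂.homEquiv _ _ b ≫ mate adj₁ adj₂ τ X = adj₁.homEquiv _ _ (τ.app K ≫ b) := by
  rw [mate, ← adj₁.homEquiv_naturality_left, τ.naturality_assoc, ← adj₂.homEquiv_counit,
    Equiv.symm_apply_apply]

lemma mate_naturality (adj₁ : F ⊣ F') (adj₂ : H ⊣ H') (τ : F ⟶ H) {X Y : D} (p : X ⟶ Y) :
    mate adj₁ adj₂ τ X ≫ F'.map p = H'.map p ≫ mate adj₁ adj₂ τ Y := by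
  rw [mate, mate, ← adj₁.homEquiv_naturality_right, ← adj₁.homEquiv_naturality_left]
  simp

/-- The pullback-corner map of `p` with respect to a transformation of left adjoints. -/
noncomputable def pullbackCorner [HasPullbacks C] (adj₁ : F ⊣ F') (adj₂ : H ⊣ H') (τ : F ⟶ H)
    {X Y : D} (p : X ⟶ Y) :
    H'.obj X ⟶ pullback (F'.map p) (mate adj₁ adj₂ τ Y) :=
  pullback.lift (mate adj₁ adj₂ τ X) (H'.map p) (mate_naturality adj₁ adj₂ τ p)

/-- The pushout-corner map of `f` with respect to a natural transformation. -/
noncomputable def pushoutCorner [HasPushouts D] (τ : F ⟶ H) {K M : C} (f : K ⟶ M) :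
    pushout (F.map f) (τ.app K) ⟶ H.obj M :=
  pushout.desc (τ.app M) (H.map f) (τ.naturality f)

lemma inl_pushoutCorner [HasPushouts D] (τ : F ⟶ H) {K M : C} (f : K ⟶ M) :
    pushout.inl _ _ ≫ pushoutCorner τ f = τ.app M :=
  pushout.inl_desc _ _ _

lemma inr_pushoutCorner [HasPushouts D] (τ : F ⟶ H) {K M : C} (f : K ⟶ M) :
    pushout.inr _ _ ≫ pushoutCorner τ f = H.map f :=
  pushout.inr_desc _ _ _

lemma pullbackCorner_fst [HasPullbacks C] (adj₁ : F ⊣ F') (adj₂ : H ⊣ H') (τ : F ⟶ H)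
    {X Y : D} (p : X ⟶ Y) :
    pullbackCorner adj₁ adj₂ τ p ≫ pullback.fst _ _ = mate adj₁ adj₂ τ X :=
  pullback.lift_fst _ _ _

lemma pullbackCorner_snd [HasPullbacks C] (adj₁ : F ⊣ F') (adj₂ : H ⊣ H') (τ : F ⟶ H)
    {X Y : D} (p : X ⟶ Y) :
    pullbackCorner adj₁ adj₂ τ p ≫ pullback.snd _ _ = H'.map p :=
  pullback.lift_snd _ _ _

lemma hasLiftingProperty_pushoutCorner_iff [HasPullbacks C] [HasPushouts D]
    (adj₁ : F ⊣ F') (adj₂ : H ⊣ H') (τ : F ⟶ H)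
    {K M : C} (f : K ⟶ M) {X Y : D} (p : X ⟶ Y) :
    HasLiftingProperty (pushoutCorner τ f) p ↔
      HasLiftingProperty f (pullbackCorner adj₁ adj₂ τ p) := by
  constructor
  · refine fun h => ⟨fun {k m} sq => ?_⟩
    have w := sq.w
    have w₁ := congrArg (· ≫ pullback.fst _ _) w
    have w₂ := congrArg (· ≫ pullback.snd _ _) w
    simp only [Category.assoc, pullbackCorner_fst, pullbackCorner_snd] at w₁ w₂
    have hm := pullback.condition (f := F'.map p) (g := mate adj₁ adj₂ τ Y)
    obtain ⟨b, rfl⟩ := (adj₂.homEquiv _ _).surjective k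
    obtain ⟨a, ha⟩ := (adj₁.homEquiv _ _).surjective (m ≫ pullback.fst _ _)
    obtain ⟨y, hy⟩ := (adj₂.homEquiv _ _).surjective (m ≫ pullback.snd _ _)
    rw [homEquiv_comp_mate, ← ha, ← adj₁.homEquiv_naturality_left] at w₁
    rw [← adj₂.homEquiv_naturality_right, ← hy, ← adj₂.homEquiv_naturality_left] at w₂
    have w₃ : a ≫ p = τ.app M ≫ y := by
      apply (adj₁.homEquiv _ _).injective
      rw [adj₁.homEquiv_naturality_right, ha, ← homEquiv_comp_mate adj₁ adj₂, hy]
      simp [hm]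
    have w₁' := (adj₁.homEquiv _ _).injective w₁
    have w₂' := (adj₂.homEquiv _ _).injective w₂
    have sq' : CommSq (pushout.desc a b w₁'.symm) (pushoutCorner τ f) p y := ⟨by
      apply pushout.hom_ext
      · rw [pushout.inl_desc_assoc, reassoc_of% inl_pushoutCorner τ f, w₃]
      · rw [pushout.inr_desc_assoc, reassoc_of% inr_pushoutCorner τ f, w₂']⟩
    have l₁ := congrArg (pushout.inl _ _ ≫ ·) sq'.fac_left
    have l₂ := congrArg (pushout.inr _ _ ≫ ·) sq'.fac_left
    rw [reassoc_of% inl_pushoutCorner τ f, pushout.inl_desc] at l₁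
    rw [reassoc_of% inr_pushoutCorner τ f, pushout.inr_desc] at l₂
    refine ⟨⟨⟨adj₂.homEquiv _ _ sq'.lift, ?_, ?_⟩⟩⟩
    · rw [← adj₂.homEquiv_naturality_left]
      exact congrArg _ l₂
    · apply pullback.hom_ext
      · rw [Category.assoc, pullbackCorner_fst, homEquiv_comp_mate, ← ha]
        exact congrArg _ l₁
      · rw [Category.assoc, pullbackCorner_snd, ← adj₂.homEquiv_naturality_right, ← hy,
          sq'.fac_right]
  · refine fun h => ⟨fun {u y} sq => ?_⟩
    have w₁ := congrArg (pushout.inl _ _ ≫ ·) sq.w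
    have w₂ := congrArg (pushout.inr _ _ ≫ ·) sq.w
    rw [reassoc_of% inl_pushoutCorner τ f] at w₁
    rw [reassoc_of% inr_pushoutCorner τ f] at w₂
    have hu := pushout.condition_assoc (f := F.map f) (g := τ.app K) u
    have hm : adj₁.homEquiv _ _ (pushout.inl _ _ ≫ u) ≫ F'.map p =
        adj₂.homEquiv _ _ y ≫ mate adj₁ adj₂ τ Y := by
      rw [homEquiv_comp_mate, ← adj₁.homEquiv_naturality_right, Category.assoc, w₁]
    have sq' : CommSq (adj₂.homEquiv _ _ (pushout.inr _ _ ≫ u)) f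
        (pullbackCorner adj₁ adj₂ τ p) (pullback.lift _ _ hm) := ⟨by
      apply pullback.hom_ext
      · rw [Category.assoc, Category.assoc, pullbackCorner_fst, pullback.lift_fst,
          homEquiv_comp_mate, ← hu, adj₁.homEquiv_naturality_left]
      · rw [Category.assoc, Category.assoc, pullbackCorner_snd, pullback.lift_snd,
          ← adj₂.homEquiv_naturality_right, ← adj₂.homEquiv_naturality_left, Category.assoc, w₂]⟩
    obtain ⟨l, hl⟩ := (adj₂.homEquiv _ _).surjective sq'.lift
    have l₁ := sq'.fac_left
    have l₂ := congrArg (· ≫ pullback.fst _ _) sq'.fac_right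
    have l₃ := congrArg (· ≫ pullback.snd _ _) sq'.fac_right
    rw [← hl, ← adj₂.homEquiv_naturality_left] at l₁
    simp only [Category.assoc, pullbackCorner_fst, pullbackCorner_snd, pullback.lift_fst,
      pullback.lift_snd] at l₂ l₃
    rw [← hl, homEquiv_comp_mate] at l₂
    rw [← hl, ← adj₂.homEquiv_naturality_right] at l₃
    refine ⟨⟨⟨l, ?_, (adj₂.homEquiv _ _).injective l₃⟩⟩⟩
    apply pushout.hom_ext
    · rw [reassoc_of% inl_pushoutCorner τ f]
      exact (adj₁.homEquiv _ _).injective l₂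
    · rw [reassoc_of% inr_pushoutCorner τ f]
      exact (adj₂.homEquiv _ _).injective l₁

/-- If the pushout-corner maps of a class `T` lie in `llp U`, so do those of the class
generated by `T`. -/
lemma llp_pushoutCorner [HasPullbacks C] [HasPushouts D] [F.IsLeftAdjoint] [H.IsLeftAdjoint]
    (τ : F ⟶ H) (T : MorphismProperty C) (U : MorphismProperty D)
    (hT : ∀ ⦃K M : C⦄ (f : K ⟶ M), T f → llp U (pushoutCorner τ f))
    {K M : C} (f : K ⟶ M) (hf : llp (rlp T) f) : llp U (pushoutCorner τ f) := by
  intro X Y p hp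
  rw [hasLiftingProperty_pushoutCorner_iff (.ofIsLeftAdjoint F) (.ofIsLeftAdjoint H)]
  refine hf _ fun A B g hg => ?_
  rw [← hasLiftingProperty_pushoutCorner_iff]
  exact hT g hg p hp

end Corner

section Cylinder

/-- The endofunctor `X ↦ X ⨿ X`. -/
@[simps]
noncomputable def selfCoprod (C : Type u) [Category.{v} C] [HasBinaryCoproducts C] : C ⥤ C where
  obj X := X ⨿ X
  map f := coprod.map f f

/-- The endofunctor `X ↦ X ⨯ X`. -/
@[simps]
noncomputable def selfProd (C : Type u) [Category.{v} C] [HasBinaryProducts C] : C ⥤ C where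
  obj X := X ⨯ X
  map f := prod.map f f

/-- The bijection between morphisms `X ⨿ X ⟶ Y` and morphisms `X ⟶ Y ⨯ Y`. -/
@[simps]
noncomputable def coprodHomEquivHomProd [HasBinaryCoproducts C] [HasBinaryProducts C] (X Y : C) :
    (X ⨿ X ⟶ Y) ≃ (X ⟶ Y ⨯ Y) where
  toFun f := prod.lift (coprod.inl ≫ f) (coprod.inr ≫ f)
  invFun g := coprod.desc (g ≫ prod.fst) (g ≫ prod.snd)
  left_inv f := by
    apply coprod.hom_ext <;>
      simp [coprod.inl_desc, coprod.inr_desc, prod.lift_fst, prod.lift_snd]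
  right_inv g := by
    apply Limits.prod.hom_ext <;>
      simp [coprod.inl_desc, coprod.inr_desc, prod.lift_fst, prod.lift_snd]

instance [HasBinaryCoproducts C] [HasBinaryProducts C] : (selfCoprod C).IsLeftAdjoint :=
  ⟨selfProd C, ⟨Adjunction.mkOfHomEquiv
    { homEquiv := coprodHomEquivHomProd
      homEquiv_naturality_left_symm := fun f g => by
        change coprod.desc _ _ = coprod.map f f ≫ coprod.desc _ _
        rw [coprod.map_desc]
        exact congrArg₂ _ (Category.assoc _ _ _) (Category.assoc _ _ _)
      homEquiv_naturality_right := fun f g => by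
        change prod.lift _ _ = prod.lift _ _ ≫ prod.map g g
        rw [prod.lift_map]
        exact congrArg₂ _ (Category.assoc _ _ _).symm (Category.assoc _ _ _).symm }⟩⟩

variable (E : Cylinder C)

/-- The natural transformation `X ⨿ X ⟶ I(X)`. -/
noncomputable def Cylinder.ιNatTrans [HasColimits C] : selfCoprod C ⟶ E.I where
  app := E.ι
  naturality _ _ f := E.ι_naturality f

variable [LocallyPresentable C] [PreservesColimits E.I]

lemma llp_box1 (T U : MorphismProperty C)
    (hT : ∀ ⦃K M : C⦄ (f : K ⟶ M), T f → llp U (E.box1 f))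
    {K M : C} (f : K ⟶ M) (hf : llp (rlp T) f) : llp U (E.box1 f) := by
  have : HasLimits C := LocallyPresentable.hasLimits
  have : E.I.IsLeftAdjoint := isLeftAdjoint_of_preservesColimits _
  exact llp_pushoutCorner E.d1 T U hT f hf

lemma llp_boundaryBox (T U : MorphismProperty C)
    (hT : ∀ ⦃K M : C⦄ (f : K ⟶ M), T f → llp U (E.boundaryBox f))
    {K M : C} (f : K ⟶ M) (hf : llp (rlp T) f) : llp U (E.boundaryBox f) := by
  have : HasLimits C := LocallyPresentable.hasLimits
  have : E.I.IsLeftAdjoint := isLeftAdjoint_of_preservesColimits _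
  exact llp_pushoutCorner E.ιNatTrans T U hT f hf

end Cylinder

lemma le_llp_rlp (T : MorphismProperty C) : T ≤ llp (rlp T) :=
  fun _ _ f hf _ _ _ hg => hg f hf

lemma llp_rlp_le {T U : MorphismProperty C} (h : T ≤ llp (rlp U)) :
    llp (rlp T) ≤ llp (rlp U) :=
  fun _ _ _ hf _ _ g hg => hf g fun _ _ t ht => h t ht g hg

section Lambda

variable [HasColimits C] (E : Cylinder C)

/-- A class containing `Λ⁰` and closed under `∂I ⊠ -` contains every `Λⁿ`. -/
lemma ofArrows_iUnion_lambdaSeq_le {S G : Set (Arrow C)} {W : MorphismProperty C}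
    (hS : ofArrows S ≤ W)
    (hG : ∀ ⦃K M : C⦄ (f : K ⟶ M), ofArrows G f → W (E.box1 f))
    (hW : ∀ ⦃K M : C⦄ (f : K ⟶ M), W f → W (E.boundaryBox f)) :
    ofArrows (⋃ n, lambdaSeq E S G n) ≤ W := by
  have h : ∀ n, ∀ a ∈ lambdaSeq E S G n, W a.hom := by
    intro n
    induction n with
    | zero =>
      rintro a (ha | ⟨K, M, f, hf, rfl⟩)
      · exact hS a.hom ha
      · exact hG f hf
    | succ n ih =>
      rintro _ ⟨K, M, f, hf, rfl⟩
      exact hW f (ih _ hf)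
  intro X Y f hf
  obtain ⟨n, hn⟩ := Set.mem_iUnion.1 hf
  exact h n _ hn

lemma small_lambdaSeq {S G : Set (Arrow C)} [Small.{v} S] [Small.{v} G] (n : ℕ) :
    Small.{v} (lambdaSeq E S G n) := by
  induction n with
  | zero =>
    have h : box1Set E G ⊆ Set.range fun a : G => Arrow.mk (E.box1 a.1.hom) := by
      rintro _ ⟨K, M, f, hf, rfl⟩
      exact ⟨⟨_, hf⟩, rfl⟩
    have : Small.{v} (box1Set E G) := small_subset h
    exact small_union _ _
  | succ n ih =>
    have h : lambdaSeq E S G (n + 1) ⊆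
        Set.range fun a : lambdaSeq E S G n => Arrow.mk (E.boundaryBox a.1.hom) := by
      rintro _ ⟨K, M, f, hf, rfl⟩
      exact ⟨⟨_, hf⟩, rfl⟩
    exact small_subset h

end Lambda

/-- Lemma 2.32 (smallanodyne): the saturated class generated by `Λ = ⋃ₙ Λⁿ` is the smallest
class of right `I`-anodyne extensions containing `S`. -/
theorem statement_10    {C : Type u} [Category.{v} C] [LocallyPresentable C]
    (L R : MorphismProperty C) (hW : IsCofGenWFS L R)
    (E : Cylinder C) (hE : IsExactCylinder E L)
    (S G : Set (Arrow C)) (hS : Small.{v} S) (hSL : ofArrows S ≤ L)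
    (hG : Small.{v} G) (hGL : L = llp (rlp (ofArrows G))) :
    IsRightAnodyneClass E L (llp (rlp (ofArrows (⋃ n, lambdaSeq E S G n)))) ∧
    (∀ An : MorphismProperty C, IsRightAnodyneClass E L An → ofArrows S ≤ An →
      llp (rlp (ofArrows (⋃ n, lambdaSeq E S G n))) ≤ An) := by
  have := hE.preservesColimits
  have hGle : ofArrows G ≤ L := hGL ▸ le_llp_rlp _
  have hΛ : ofArrows (⋃ n, lambdaSeq E S G n) ≤ L :=
    ofArrows_iUnion_lambdaSeq_le E hSL (fun _ _ f hf => hE.box1_mem f (hGle f hf))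
      hE.boundaryBox_mem
  refine ⟨⟨?_, ⟨_, ?_, hΛ, rfl⟩, fun K M f hf => ?_, fun K M f hf => ?_⟩, fun An hAn hSAn => ?_⟩
  · rw [hGL] at hΛ ⊢
    exact llp_rlp_le hΛ
  · have := small_lambdaSeq E (S := S) (G := G)
    exact small_iUnion _
  · rw [hGL] at hf
    refine llp_box1 E (ofArrows G) _ (fun K M g hg => le_llp_rlp _ _ ?_) f hf
    exact Set.mem_iUnion.2 ⟨0, Or.inr ⟨K, M, g, hg, rfl⟩⟩
  · refine llp_boundaryBox E _ _ (fun K M g hg => le_llp_rlp _ _ ?_) f hf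
    obtain ⟨n, hn⟩ := Set.mem_iUnion.1 hg
    exact Set.mem_iUnion.2 ⟨n + 1, K, M, g, hn, rfl⟩
  · have hAnΛ := ofArrows_iUnion_lambdaSeq_le E hSAn
      (fun _ _ f hf => hAn.box1_mem f (hGle f hf)) hAn.boundaryBox_mem
    obtain ⟨Λ', -, -, rfl⟩ := hAn.exists_generating_set
    exact llp_rlp_le hAnΛ

end Paper
end

section
/- Let C be a locally presentable category with a cofibrantly generated weak factorization system (L, R) such that ∅ → X lies in L for every object X, equipped with an exact cylinder I, a class An(I) of right I-anodyne extensions and a class An^l(I) of left I-anodyne extensions. Then every right deformation retract is a right I-anodyne extension (lies in An(I)), and every left deformation retract is a left I-anodyne extension (lies in An^l(I)). -/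
set_option linter.unusedSectionVars false

open CategoryTheory CategoryTheory.Limits

universe v u

namespace Paper

variable {C : Type u} [Category.{v} C]

/-- `i : A ⟶ X` is a right deformation retract. -/
def Cylinder.IsRightDefRetract (E : Cylinder C) {A X : C} (i : A ⟶ X) : Prop :=
  ∃ (r : X ⟶ A) (h : E.I.obj X ⟶ X),
    i ≫ r = 𝟙 A ∧ E.d0.app X ≫ h = 𝟙 X ∧ E.d1.app X ≫ h = r ≫ i ∧
    E.I.map i ≫ h = E.σ.app A ≫ i

/-- `i : A ⟶ X` is a left deformation retract (the roles of `∂0` and `∂1` are exchanged). -/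
def Cylinder.IsLeftDefRetract (E : Cylinder C) {A X : C} (i : A ⟶ X) : Prop :=
  ∃ (r : X ⟶ A) (h : E.I.obj X ⟶ X),
    i ≫ r = 𝟙 A ∧ E.d1.app X ≫ h = 𝟙 X ∧ E.d0.app X ≫ h = r ≫ i ∧
    E.I.map i ≫ h = E.σ.app A ≫ i

/-- Every object of a locally presentable category is presentable. -/
lemma exists_isCardinalPresentable [LocallyPresentable C] (X : C) :
    ∃ (κ : Cardinal.{v}) (_ : Fact κ.IsRegular), IsCardinalPresentable X κ := by
  obtain ⟨κ, hκ, ι, G, hG, hX⟩ := LocallyPresentable.exists_presentable_generator (C := C)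
  have : Fact κ.IsRegular := ⟨hκ⟩
  have hG' (i : ι) : IsCardinalPresentable (G i) κ :=
    { preservesColimitOfShape := fun J _ hJ => hG i (Cat.of J) (fun K hK F =>
        hJ.nonempty_cocone F ((hasCardinalLT_iff_cardinal_mk_lt _ _).2 hK)) }
  obtain ⟨J, F, c, -, ⟨hc⟩, hF, ⟨e⟩⟩ := hX X
  have hle : Cardinal.aleph0 ≤ max κ (Cardinal.mk (Arrow J)) := hκ.aleph0_le.trans (le_max_left _ _)
  have : Fact (Order.succ (max κ (Cardinal.mk (Arrow J)))).IsRegular :=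
    ⟨Cardinal.isRegular_succ hle⟩
  refine ⟨Order.succ (max κ (Cardinal.mk (Arrow J))), this, ?_⟩
  have hF' (j : J) :
      IsCardinalPresentable (F.obj j) (Order.succ (max κ (Cardinal.mk (Arrow J)))) := by
    obtain ⟨i, ⟨e'⟩⟩ := hF j
    have := isCardinalPresentable_of_iso e'.symm κ
    exact isCardinalPresentable_of_le _ ((le_max_left _ _).trans (Order.le_succ _))
  have := isCardinalPresentable_of_isColimit c hc (Order.succ (max κ (Cardinal.mk (Arrow J))))
    ((hasCardinalLT_iff_cardinal_mk_lt _ _).2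
      ((le_max_right _ _).trans_lt (Order.lt_succ _)))
  exact isCardinalPresentable_of_iso e _

/-- A small family of objects of a locally presentable category is uniformly presentable. -/
lemma exists_forall_isCardinalPresentable [LocallyPresentable C] {ι : Type v} (X : ι → C) :
    ∃ (κ : Cardinal.{v}) (_ : Fact κ.IsRegular), ∀ i, IsCardinalPresentable (X i) κ := by
  choose κ hκ h using fun i => exists_isCardinalPresentable (X i)
  have : Fact (Order.succ (max Cardinal.aleph0 (iSup κ))).IsRegular :=
    ⟨Cardinal.isRegular_succ (le_max_left _ _)⟩
  refine ⟨_, this, fun i => isCardinalPresentable_of_le _ (κ := κ i) ?_⟩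
  exact (le_ciSup Cardinal.bddAbove_of_small i).trans
    ((le_max_right _ _).trans (Order.le_succ _))

/-- The morphisms of `J ⥤ C` freely generated, at each object of `J`, by a family of morphisms
of `C`. -/
noncomputable def freeHom [HasColimits C] (J : Type v) [SmallCategory J] {ι : Type v}
    {S T : ι → C} (f : ∀ i, S i ⟶ T i) (x : ι × J) :
    (evaluationLeftAdjoint C x.2).obj (S x.1) ⟶ (evaluationLeftAdjoint C x.2).obj (T x.1) :=
  (evaluationLeftAdjoint C x.2).map (f x.1)

/-- The right lifting property against `freeHom J f` is the objectwise right lifting property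
against `f`. -/
lemma rlp_ofHoms_freeHom_iff [HasColimits C] {J : Type v} [SmallCategory J] {ι : Type v}
    {S T : ι → C} (f : ∀ i, S i ⟶ T i) {F G : J ⥤ C} (p : F ⟶ G) :
    (MorphismProperty.ofHoms (freeHom J f)).rlp p ↔
      ∀ j, (MorphismProperty.ofHoms f).rlp (p.app j) := by
  constructor
  · rintro h j _ _ _ ⟨i⟩
    exact ((evaluationAdjunctionRight C j).hasLiftingProperty_iff (f i) p).1
      (h _ (.mk (i, j)))
  · rintro h _ _ _ ⟨⟨i, j⟩⟩
    exact ((evaluationAdjunctionRight C j).hasLiftingProperty_iff (f i) p).2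
      (h j _ (.mk i))

/-- The objectwise weak factorization system on diagrams over `κ.ord.ToType`, obtained from the
small object argument. -/
lemma hasFactorization_freeHom [HasColimits C] {κ : Cardinal.{v}} [Fact κ.IsRegular] {ι : Type v}
    {S T : ι → C} (f : ∀ i, S i ⟶ T i) [∀ i, IsCardinalPresentable (S i) κ] :
    MorphismProperty.HasFactorization
      (MorphismProperty.ofHoms (freeHom κ.ord.ToType f)).rlp.llp
      (MorphismProperty.ofHoms (freeHom κ.ord.ToType f)).rlp := by
  have hκ : κ.IsRegular := Fact.out
  have : NoMaxOrder κ.ord.ToType := Cardinal.noMaxOrder hκ.aleph0_le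
  have : Nonempty κ.ord.ToType := IsCardinalFiltered.nonempty _ κ
  let := WellFoundedLT.toOrderBot κ.ord.ToType
  have : (MorphismProperty.ofHoms
      (freeHom κ.ord.ToType f)).IsCardinalForSmallObjectArgument κ :=
    { preservesColimit := by
        rintro _ _ _ _ _ ⟨i, j⟩ _ hf
        have := (evaluationAdjunctionRight C j).isCardinalPresentable_leftAdjoint_obj κ (S i)
        have := preservesColimitsOfShape_of_isCardinalPresentable
          ((evaluationLeftAdjoint C j).obj (S i)) κ κ.ord.ToType
        exact inferInstanceAs (PreservesColimit hf.F
          (coyoneda.obj (.op ((evaluationLeftAdjoint C j).obj (S i))))) }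
  have : (MorphismProperty.ofHoms
    (freeHom κ.ord.ToType f)).HasSmallObjectArgument := ⟨κ, inferInstance, inferInstance, this⟩
  infer_instance

/-- The right lifting property against morphisms between `κ`-presentable objects passes to
`κ`-filtered colimits. -/
lemma rlp_colimMap [HasColimits C] {κ : Cardinal.{v}} [Fact κ.IsRegular] {ι : Type v}
    {S T : ι → C} (f : ∀ i, S i ⟶ T i) [∀ i, IsCardinalPresentable (S i) κ]
    [∀ i, IsCardinalPresentable (T i) κ] {J : Type v} [SmallCategory J]
    [CategoryTheory.IsCardinalFiltered J κ] {F G : J ⥤ C} (q : F ⟶ G)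
    (hq : ∀ j, (MorphismProperty.ofHoms f).rlp (q.app j)) :
    (MorphismProperty.ofHoms f).rlp (colimMap q) := by
  have := isFiltered_of_isCardinalFiltered J κ
  rintro _ _ _ ⟨i⟩
  refine ⟨fun {a b} sq => ?_⟩
  obtain ⟨j₁, a', ha⟩ := IsCardinalPresentable.exists_hom_of_isColimit κ (colimit.isColimit F) a
  obtain ⟨j₂, b', hb⟩ := IsCardinalPresentable.exists_hom_of_isColimit κ (colimit.isColimit G) b
  obtain ⟨j, u₁, u₂, h⟩ := IsCardinalPresentable.exists_eq_of_isColimit κ (colimit.isColimit G)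
    (a' ≫ q.app j₁) (f i ≫ b') (by
      have := sq.w
      rw [← ha, ← hb] at this
      simpa using this)
  have := hq j (f i) (.mk i)
  have sq' : CommSq (a' ≫ F.map u₁) (f i) (q.app j) (b' ≫ G.map u₂) :=
    ⟨by simpa using h⟩
  refine ⟨⟨⟨sq'.lift ≫ colimit.ι F j, ?_, ?_⟩⟩⟩
  · rw [sq'.fac_left_assoc, ← ha]
    simp
  · rw [Category.assoc, ι_colimMap, sq'.fac_right_assoc, ← hb]
    simp

/-- For `i : A ⟶ X`, the diagram obtained from the constant diagram at `A` by freely gluing, at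
each object of the indexing category, a copy of `X` along `i`. -/
lemma exists_free_amalgam [HasColimits C] (J : Type v) [SmallCategory J] {A X : C} (i : A ⟶ X) :
    ∃ (P : J ⥤ C) (u : (Functor.const J).obj A ⟶ P) (x : ∀ j, X ⟶ P.obj j),
      (∀ j, i ≫ x j = u.app j) ∧
      ∀ (G : J ⥤ C) (g : (Functor.const J).obj A ⟶ G) (h : ∀ j, X ⟶ G.obj j),
        (∀ j, i ≫ h j = g.app j) → ∃ m : P ⟶ G, u ≫ m = g ∧ ∀ j, x j ≫ m.app j = h j := by
  let adj (j : J) := evaluationAdjunctionRight C j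
  let l : ∐ (fun j : J => (evaluationLeftAdjoint C j).obj A) ⟶ (Functor.const J).obj A :=
    Sigma.desc fun j => ((adj j).homEquiv A ((Functor.const J).obj A)).symm (𝟙 A)
  let r : ∐ (fun j : J => (evaluationLeftAdjoint C j).obj A) ⟶
      ∐ (fun j : J => (evaluationLeftAdjoint C j).obj X) :=
    Limits.Sigma.map fun j => (evaluationLeftAdjoint C j).map i
  let x (j : J) : X ⟶ (pushout l r).obj j :=
    (adj j).homEquiv X (pushout l r)
      (Sigma.ι (fun j : J => (evaluationLeftAdjoint C j).obj X) j ≫ pushout.inr l r)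
  refine ⟨pushout l r, pushout.inl l r, x, fun j => ?_, fun G g h hg => ?_⟩
  · have h₁ := Sigma.ι (fun j : J => (evaluationLeftAdjoint C j).obj A) j ≫=
      pushout.condition (f := l) (g := r)
    have h₂ := congrArg ((adj j).homEquiv A (pushout l r)) h₁
    simp only [l, r, Sigma.ι_desc_assoc, Sigma.ι_map_assoc] at h₂
    rw [Adjunction.homEquiv_naturality_left, Adjunction.homEquiv_naturality_right,
      Equiv.apply_symm_apply] at h₂
    exact h₂.symm.trans (Category.id_comp _)
  · let m' : ∐ (fun j : J => (evaluationLeftAdjoint C j).obj X) ⟶ G :=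
      Sigma.desc fun j => ((adj j).homEquiv X G).symm (h j)
    have hm : l ≫ g = r ≫ m' := by
      refine Sigma.hom_ext _ _ fun j => ?_
      simp only [l, r, m', Sigma.ι_desc_assoc, Sigma.ι_map_assoc, Sigma.ι_desc]
      rw [← Adjunction.homEquiv_naturality_right_symm, ← Adjunction.homEquiv_naturality_left_symm,
        hg]
      exact congrArg _ (Category.id_comp _)
    refine ⟨pushout.desc g m' hm, pushout.inl_desc _ _ _, fun j => ?_⟩
    have := (adj j).homEquiv_naturality_right
      (Sigma.ι (fun j : J => (evaluationLeftAdjoint C j).obj X) j ≫ pushout.inr l r)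
      (pushout.desc g m' hm)
    refine this.symm.trans ?_
    rw [Category.assoc, pushout.inr_desc, Sigma.ι_desc, Equiv.apply_symm_apply]

/-- If every object is cofibrant for a cofibrantly generated weak factorization system on a locally
presentable category, then every split monomorphism belongs to its left class. -/
lemma llp_rlp_of_retraction [LocallyPresentable C] {ι : Type v} {S T : ι → C}
    (f : ∀ k, S k ⟶ T k)
    (hf : ∀ X : C, (MorphismProperty.ofHoms f).rlp.llp (initial.to X))
    {A X : C} (i : A ⟶ X) (r : X ⟶ A) (hr : i ≫ r = 𝟙 A) :
    (MorphismProperty.ofHoms f).rlp.llp i := by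
  obtain ⟨κ, hκ, hpres⟩ := exists_forall_isCardinalPresentable
    (Option.elim · A (Sum.elim S T) : Option (ι ⊕ ι) → C)
  have (k : ι) : IsCardinalPresentable (S k) κ := hpres (some (.inl k))
  have (k : ι) : IsCardinalPresentable (T k) κ := hpres (some (.inr k))
  have : IsCardinalPresentable A κ := hpres none
  have : NoMaxOrder κ.ord.ToType := Cardinal.noMaxOrder hκ.out.aleph0_le
  have := isFiltered_of_isCardinalFiltered κ.ord.ToType κ
  obtain ⟨P, u, x, hx, hP⟩ := exists_free_amalgam κ.ord.ToType i
  have hu {j k : κ.ord.ToType} (φ : j ⟶ k) : u.app j ≫ P.map φ = u.app k :=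
    (u.naturality φ).symm.trans (Category.id_comp _)
  have fact := (hasFactorization_freeHom (κ := κ) f).nonempty_mapFactorizationData (initial.to P)
  obtain ⟨F, z, q, -, hz, hq⟩ := fact
  rw [rlp_ofHoms_freeHom_iff] at hq
  -- a section of the colimit of `q`
  have := hf (colimit P) _ (rlp_colimMap (κ := κ) f q hq)
  have sqs : CommSq (initial.to (colimit F)) (initial.to (colimit P)) (colimMap q) (𝟙 _) :=
    ⟨initial.hom_ext _ _⟩
  let s := sqs.lift
  have hs : s ≫ colimMap q = 𝟙 _ := sqs.fac_right
  -- its restriction to `A` factors through a stage `α`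
  obtain ⟨α, t, ht, htu⟩ : ∃ (α : κ.ord.ToType) (t : A ⟶ F.obj α),
      t ≫ colimit.ι F α = u.app α ≫ colimit.ι P α ≫ s ∧ t ≫ q.app α = u.app α := by
    obtain ⟨β⟩ : Nonempty κ.ord.ToType := IsFiltered.nonempty
    obtain ⟨γ, t, ht⟩ := IsCardinalPresentable.exists_hom_of_isColimit (X := A) κ (colimit.isColimit F)
      (u.app β ≫ colimit.ι P β ≫ s)
    obtain ⟨α, φ, ψ, h⟩ := IsCardinalPresentable.exists_eq_of_isColimit (X := A) κ
      (colimit.isColimit P)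
      (t ≫ q.app γ) (u.app β) (by
        have := ht =≫ colimMap q
        simpa [hs] using this)
    refine ⟨α, t ≫ F.map φ, ?_, ?_⟩
    · have h₁ : u.app α ≫ colimit.ι P α ≫ s = u.app β ≫ colimit.ι P β ≫ s := by
        rw [← hu ψ, Category.assoc, colimit.w_assoc]
      rw [h₁, ← ht]
      simp
    · rw [Category.assoc, q.naturality, ← Category.assoc, h, hu]
  obtain ⟨j, hj⟩ := exists_gt α
  intro Y Z p hp
  refine ⟨fun {a b} sq => ?_⟩
  -- the diagram equal to `Y` up to stage `α` and to `Z` afterwards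
  let χ : κ.ord.ToType ⥤ Fin 2 := Monotone.functor (f := fun γ => if γ ≤ α then 0 else 1) (by
    intro γ δ h
    dsimp only
    split_ifs with h₁ h₂
    · exact le_rfl
    · exact Fin.zero_le _
    · exact absurd (h.trans ‹_›) h₁
    · exact le_rfl)
  have hχα : χ.obj α = 0 := if_pos le_rfl
  have hχj : χ.obj j = 1 := if_neg hj.not_ge
  let B : ComposableArrows C 1 := ComposableArrows.mk₁ p
  let e : (Functor.const (Fin 2)).obj Y ⟶ B :=
    ComposableArrows.homMk₁ (𝟙 Y) p rfl
  let π : B ⟶ (Functor.const (Fin 2)).obj Z :=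
    ComposableArrows.homMk₁ p (𝟙 Z) rfl
  let y (k : Fin 2) : X ⟶ B.obj k :=
    match k with
    | 0 => r ≫ a
    | 1 => b
  have hy (k : Fin 2) : i ≫ y k = a ≫ e.app k := by
    match k with
    | 0 => exact (by simp [reassoc_of% hr] : i ≫ r ≫ a = a ≫ 𝟙 Y)
    | 1 => exact sq.w.symm
  have he (k : Fin 2) : (MorphismProperty.ofHoms f).rlp (e.app k) := by
    match k with
    | 0 => exact MorphismProperty.id_mem (MorphismProperty.ofHoms f).rlp Y
    | 1 => exact hp
  have heπ (k : Fin 2) : e.app k ≫ π.app k = p := by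
    match k with
    | 0 => exact Category.id_comp p
    | 1 => exact Category.comp_id p
  have hyπ (k : Fin 2) (hk : k = 1) : y k ≫ π.app k = b := by
    subst hk
    exact Category.comp_id b
  have hinj (k : Fin 2) (hk : k = 0) (w w' : A ⟶ Y) (h : w ≫ e.app k = w' ≫ e.app k) :
      w = w' := by
    subst hk
    exact (Category.comp_id w).symm.trans (h.trans (Category.comp_id w'))
  let e' : (Functor.const κ.ord.ToType).obj Y ⟶ χ ⋙ B := Functor.whiskerLeft χ e
  let π' : χ ⋙ B ⟶ (Functor.const κ.ord.ToType).obj Z := Functor.whiskerLeft χ π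
  obtain ⟨m, hum, hxm⟩ := hP (χ ⋙ B) ((Functor.const _).map a ≫ e') (fun γ => y (χ.obj γ))
    (fun γ => hy _)
  have := hz e' ((rlp_ofHoms_freeHom_iff f e').2 fun γ => he _)
  have sqe : CommSq (initial.to _) z e' (q ≫ m) := ⟨initial.hom_ext _ _⟩
  let w := sqe.lift
  have hw (γ : κ.ord.ToType) : w.app γ ≫ e'.app γ = q.app γ ≫ m.app γ :=
    NatTrans.congr_app sqe.fac_right γ
  let wd : colimit F ⟶ Y := colimit.desc F (Cocone.mk Y w)
  let vd : colimit P ⟶ Z := colimit.desc P (Cocone.mk Z (m ≫ π'))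
  have hwv : wd ≫ p = colimMap q ≫ vd := by
    refine colimit.hom_ext fun γ => ?_
    rw [colimit.ι_desc_assoc, ι_colimMap_assoc, colimit.ι_desc]
    change w.app γ ≫ p = q.app γ ≫ m.app γ ≫ π'.app γ
    rw [← heπ (χ.obj γ), ← reassoc_of% hw γ]
    rfl
  refine ⟨⟨⟨x j ≫ colimit.ι P j ≫ s ≫ wd, ?_, ?_⟩⟩⟩
  · have h₁ : i ≫ x j ≫ colimit.ι P j = u.app α ≫ colimit.ι P α := by
      rw [reassoc_of% hx j, ← hu (homOfLE hj.le), Category.assoc, colimit.w]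
    rw [reassoc_of% h₁, ← reassoc_of% ht, colimit.ι_desc]
    refine hinj _ hχα _ _ ((Category.assoc _ _ _).trans ((t ≫= hw α).trans ?_))
    rw [reassoc_of% htu]
    exact NatTrans.congr_app hum α
  · rw [Category.assoc, Category.assoc, Category.assoc, hwv, reassoc_of% hs, colimit.ι_desc]
    exact (Category.assoc _ _ _).symm.trans ((hxm j =≫ π'.app j).trans (hyπ _ hχj))

/-- If every object is cofibrant, then every split monomorphism is a cofibration. -/
lemma IsCofGenWFS.mem_of_retraction [LocallyPresentable C] {L R : MorphismProperty C}
    (hW : IsCofGenWFS L R) {A X : C} (i : A ⟶ X) (r : X ⟶ A) (hr : i ≫ r = 𝟙 A) : L i := by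
  obtain ⟨S, hS, rfl⟩ := hW.exists_generating_set
  have : MorphismProperty.IsSmall.{v} (ofArrows S) :=
    ⟨small_of_injective (β := S) (f := fun g => ⟨g.1, g.2⟩) fun _ _ h =>
      Subtype.ext (congrArg Subtype.val h)⟩
  obtain ⟨ι, S', T', f, hf⟩ := (MorphismProperty.isSmall_iff_eq_ofHoms.{v} (ofArrows S)).1 this
  have hini := hW.initial_mem
  rw [hf] at hini ⊢
  exact llp_rlp_of_retraction f hini i r hr

/-- A deformation retract `i` has the left lifting property against any morphism against which
the pushout-corner map of `i` with a cylinder end inclusion does. -/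
lemma hasLiftingProperty_of_corner [HasColimits C] {A X IA IX Y Z : C} {i : A ⟶ X}
    {d d' : A ⟶ IA} {σ : IA ⟶ A} {D D' : X ⟶ IX} {f : IA ⟶ IX} (hd : d ≫ σ = 𝟙 A)
    (hd' : d' ≫ σ = 𝟙 A) (hD : i ≫ D = d ≫ f) (hD' : i ≫ D' = d' ≫ f) {r : X ⟶ A} {h : IX ⟶ X}
    (hr : i ≫ r = 𝟙 A) (h₀ : D' ≫ h = 𝟙 X) (h₁ : D ≫ h = r ≫ i) (hf : f ≫ h = σ ≫ i)
    (p : Y ⟶ Z) [HasLiftingProperty (pushout.desc D f hD) p] : HasLiftingProperty i p := by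
  refine ⟨fun {a b} sq => ?_⟩
  have sq' : CommSq (pushout.desc (r ≫ a) (σ ≫ a) (by rw [reassoc_of% hr, reassoc_of% hd]))
      (pushout.desc D f hD) p (h ≫ b) := ⟨by
    apply pushout.hom_ext
    · rw [pushout.inl_desc_assoc, pushout.inl_desc_assoc, Category.assoc, sq.w, reassoc_of% h₁]
    · rw [pushout.inr_desc_assoc, pushout.inr_desc_assoc, Category.assoc, sq.w, reassoc_of% hf]⟩
  refine ⟨⟨⟨D' ≫ sq'.lift, ?_, ?_⟩⟩⟩
  · have hl : f ≫ sq'.lift = σ ≫ a := by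
      simpa only [pushout.inr_desc_assoc, pushout.inr_desc] using
        pushout.inr i d ≫= sq'.fac_left
    rw [reassoc_of% hD', hl, reassoc_of% hd']
  · rw [Category.assoc, sq'.fac_right, reassoc_of% h₀]

lemma IsRightAnodyneClass.mem_of_isRightDefRetract [HasColimits C] {L An : MorphismProperty C}
    {E : Cylinder C} (hAn : IsRightAnodyneClass E L An) {A X : C} {i : A ⟶ X} (hi : L i)
    (h : E.IsRightDefRetract i) : An i := by
  obtain ⟨r, h, hr, h₀, h₁, hI⟩ := h
  have hbox := hAn.box1_mem i hi
  obtain ⟨Λ, -, -, rfl⟩ := hAn.exists_generating_set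
  intro Y Z p hp
  have : HasLiftingProperty (pushout.desc _ _ (E.d1_naturality' i)) p := hbox p hp
  exact hasLiftingProperty_of_corner (E.d1_σ A) (E.d0_σ A) (E.d1_naturality' i)
    (E.d0_naturality' i) hr h₀ h₁ hI p

lemma IsLeftAnodyneClass.mem_of_isLeftDefRetract [HasColimits C] {L An : MorphismProperty C}
    {E : Cylinder C} (hAn : IsLeftAnodyneClass E L An) {A X : C} {i : A ⟶ X} (hi : L i)
    (h : E.IsLeftDefRetract i) : An i := by
  obtain ⟨r, h, hr, h₀, h₁, hI⟩ := h
  have hbox := hAn.box0_mem i hi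
  obtain ⟨Λ, -, -, rfl⟩ := hAn.exists_generating_set
  intro Y Z p hp
  have : HasLiftingProperty (pushout.desc _ _ (E.d0_naturality' i)) p := hbox p hp
  exact hasLiftingProperty_of_corner (E.d0_σ A) (E.d1_σ A) (E.d0_naturality' i)
    (E.d1_naturality' i) hr h₀ h₁ hI p

/-- Lemma 3.12 (deformright): every right deformation retract is right `I`-anodyne and every
left deformation retract is left `I`-anodyne. -/
theorem statement_14    {C : Type u} [Category.{v} C] [LocallyPresentable C]
    (L R : MorphismProperty C) (hW : IsCofGenWFS L R)
    (E : Cylinder C) (hE : IsExactCylinder E L)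
    (An : MorphismProperty C) (hAn : IsRightAnodyneClass E L An)
    (Anl : MorphismProperty C) (hAnl : IsLeftAnodyneClass E L Anl) :
    (∀ ⦃A X : C⦄ (i : A ⟶ X), E.IsRightDefRetract i → An i) ∧
    (∀ ⦃A X : C⦄ (i : A ⟶ X), E.IsLeftDefRetract i → Anl i) := by
  refine ⟨fun _ _ i h => hAn.mem_of_isRightDefRetract ?_ h,
    fun _ _ i h => hAnl.mem_of_isLeftDefRetract ?_ h⟩ <;>
  · obtain ⟨r, -, hr, -⟩ := h
    exact hW.mem_of_retraction i r hr

end Paper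
end

section
/- Let C be a locally presentable category with a cofibrantly generated weak factorization system (L, R) such that ∅ → X lies in L for every object X, equipped with an exact cylinder I, a class An(I) of right I-anodyne extensions and a class An^l(I) of left I-anodyne extensions. Consider a cartesian (pullback) square in C with top morphism j : A → X, right morphism p : X → Y, bottom morphism i : B → Y and left morphism A → B. If i is a right deformation retract and p is a left I-fibration, then j is a right deformation retract. Dually, if i is a left deformation retract and p is a right I-fibration, then j is a left deformation retract. -/
set_option linter.unusedSectionVars false

open CategoryTheory CategoryTheory.Limits

universe v u

namespace Paper

variable {C : Type u} [Category.{v} C]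

lemma IsCardinalFiltered.of_mathlib {J : Type v} [SmallCategory J] {κ : Cardinal.{v}}
    [Fact κ.IsRegular] [CategoryTheory.IsCardinalFiltered J κ] :
    IsCardinalFiltered (Cat.of J) κ := fun K hK F =>
  (inferInstance : CategoryTheory.IsCardinalFiltered J κ).nonempty_cocone F
    (by rwa [hasCardinalLT_iff_cardinal_mk_lt])

lemma IsCardinalFiltered.toMathlib {J : Cat.{v, v}} {κ : Cardinal.{v}} [Fact κ.IsRegular]
    (h : IsCardinalFiltered J κ) : CategoryTheory.IsCardinalFiltered J κ where
  nonempty_cocone {A} _ F hA :=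
    h (Cat.of A) (by rwa [hasCardinalLT_iff_cardinal_mk_lt] at hA) F

lemma IsPresentableObj.isCardinalPresentable {C : Type u} [Category.{v} C] {κ : Cardinal.{v}}
    [Fact κ.IsRegular] {X : C} (h : IsPresentableObj κ X) : IsCardinalPresentable X κ where
  preservesColimitOfShape J _ _ := h (Cat.of J) IsCardinalFiltered.of_mathlib

lemma LocallyPresentable.exists_generator (C : Type u) [Category.{v} C] [LocallyPresentable C] :
    ∃ (ι : Type v) (G : ι → C) (κ : Cardinal.{v}) (_ : Fact κ.IsRegular),
      (ObjectProperty.ofObj G).IsCardinalFilteredGenerator κ := by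
  obtain ⟨κ, hκ, ι, G, hG, hX⟩ := LocallyPresentable.exists_presentable_generator (C := C)
  have : Fact κ.IsRegular := ⟨hκ⟩
  refine ⟨ι, G, κ, ⟨hκ⟩, ObjectProperty.IsCardinalFilteredGenerator.isoClosure_iff.1 ⟨?_, ?_⟩⟩
  · rw [ObjectProperty.isoClosure_le_iff]
    rintro _ ⟨i⟩
    exact (hG i).isCardinalPresentable
  · intro X
    obtain ⟨J, F, c, hJ, ⟨hc⟩, hF, ⟨e⟩⟩ := hX X
    refine ⟨J, inferInstance, hJ.toMathlib,
      ⟨⟨⟨F, c.ι ≫ (Functor.const _).map e.hom, IsColimit.ofIsoColimit hc (Cocone.ext e)⟩, ?_⟩⟩⟩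
    intro j
    obtain ⟨i, ⟨e'⟩⟩ := hF j
    exact ⟨G i, ⟨i⟩, ⟨e'⟩⟩

lemma LocallyPresentable.isPresentable {C : Type u} [Category.{v} C] [LocallyPresentable C]
    (X : C) : IsPresentable.{v} X := by
  obtain ⟨ι, G, κ, _, h⟩ := exists_generator C
  exact h.presentable X

lemma LocallyPresentable.exists_isCardinalPresentable_forall {C : Type u} [Category.{v} C]
    [LocallyPresentable C] {ι : Type v} (X : ι → C) :
    ∃ (κ : Cardinal.{v}) (_ : Fact κ.IsRegular), ∀ i, IsCardinalPresentable (X i) κ := by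
  have hX (i : ι) : ∃ (κ : Cardinal.{v}) (_ : Fact κ.IsRegular), IsCardinalPresentable (X i) κ :=
    (LocallyPresentable.isPresentable (X i)).exists_cardinal
  choose κ hκ h using hX
  obtain ⟨κ', h₁, h₂⟩ := HasCardinalLT.exists_regular_cardinal_forall.{v}
    (fun i ↦ (κ i).ord.ToType)
  have : Fact κ'.IsRegular := ⟨h₁⟩
  refine ⟨κ', this, fun i ↦ isCardinalPresentable_of_le (X i) (κ := κ i) ?_⟩
  exact le_of_lt (by simpa [hasCardinalLT_iff_cardinal_mk_lt] using h₂ i)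


lemma isLeftAdjoint_of_preservesColimits_of_full {A : Type v} [SmallCategory A]
    {C : Type u} [Category.{v} C] [HasColimits C] (Q : A ⥤ C) [Q.Full]
    (hQ : ∀ X : C, ∃ (J : Type v) (_ : SmallCategory J) (p : ColimitPresentation J X),
      ∀ j, ∃ a, Nonempty (Q.obj a ≅ p.diag.obj j))
    {D : Type*} [Category.{v} D] (F : C ⥤ D) [PreservesColimitsOfSize.{v, v} F] :
    F.IsLeftAdjoint := by
  suffices h : SolutionSetCondition.{v} F.op by
    have := preservesLimits_op F
    have : F.op.IsRightAdjoint := isRightAdjoint_of_preservesLimits_of_solutionSetCondition _ h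
    exact ⟨_, ⟨(Adjunction.ofIsRightAdjoint F.op).unop⟩⟩
  intro Y
  let K : CostructuredArrow (Q ⋙ F) Y.unop ⥤ C := CostructuredArrow.proj _ _ ⋙ Q
  let s : Cocone (K ⋙ F) := ⟨Y.unop,
    { app := fun k ↦ k.hom
      naturality := fun _ _ f ↦ (CostructuredArrow.w f).trans (Category.comp_id _).symm }⟩
  let t : F.obj (colimit K) ⟶ Y.unop := (isColimitOfPreserves F (colimit.isColimit K)).desc s
  have ht (k) : F.map (colimit.ι K k) ≫ t = k.hom :=
    (isColimitOfPreserves F (colimit.isColimit K)).fac s k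
  refine ⟨PUnit, fun _ ↦ .op (colimit K), fun _ ↦ t.op, fun X x ↦ ⟨⟨⟩, ?_⟩⟩
  suffices h : ∃ g : X.unop ⟶ colimit K, F.map g ≫ t = x.unop by
    obtain ⟨g, hg⟩ := h
    exact ⟨g.op, Quiver.Hom.unop_inj (by simpa using hg)⟩
  obtain ⟨J, _, p, hp⟩ := hQ X.unop
  choose a e using hp
  replace e := fun j ↦ (e j).some
  let k (j : J) : CostructuredArrow (Q ⋙ F) Y.unop :=
    CostructuredArrow.mk (Y := a j) (F.map ((e j).hom ≫ p.ι.app j) ≫ x.unop)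
  let φ (j : J) : Q.obj (a j) ⟶ colimit K := colimit.ι K (k j)
  have hφ (j : J) : F.map (φ j) ≫ t = F.map ((e j).hom ≫ p.ι.app j) ≫ x.unop := ht (k j)
  let c : Cocone p.diag :=
    ⟨colimit K, { app := fun j ↦ (e j).inv ≫ φ j, naturality := fun j j' u ↦ ?_ }⟩
  · refine ⟨p.isColimit.desc c, (isColimitOfPreserves F p.isColimit).hom_ext fun j ↦ ?_⟩
    have h₁ : p.ι.app j ≫ p.isColimit.desc c = (e j).inv ≫ φ j := p.isColimit.fac c j
    have h₂ : F.map (p.ι.app j) ≫ F.map (p.isColimit.desc c) = F.map ((e j).inv ≫ φ j) := by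
      rw [← F.map_comp, h₁]
    change F.map (p.ι.app j) ≫ F.map (p.isColimit.desc c) ≫ t = F.map (p.ι.app j) ≫ x.unop
    rw [reassoc_of% h₂, F.map_comp, Category.assoc, hφ]
    simp [← F.map_comp_assoc, -Functor.map_comp]
  · let f : k j ⟶ k j' := CostructuredArrow.homMk
      (Q.preimage ((e j).hom ≫ p.diag.map u ≫ (e j').inv)) (by
        have h : p.diag.map u ≫ p.ι.app j' = p.ι.app j := by simp
        simp [k, ← F.map_comp_assoc, -Functor.map_comp, h])
    have h : Q.map (Q.preimage ((e j).hom ≫ p.diag.map u ≫ (e j').inv)) ≫ φ j' = φ j :=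
      colimit.w K f
    simp [← h]

namespace LocallyPresentable

variable {C : Type u} [Category.{v} C] [LocallyPresentable C]

lemma isLeftAdjoint_of_preservesColimits {D : Type*} [Category.{v} D] (F : C ⥤ D)
    [PreservesColimitsOfSize.{v, v} F] : F.IsLeftAdjoint := by
  obtain ⟨ι, G, κ, _, hG⟩ := exists_generator C
  refine isLeftAdjoint_of_preservesColimits_of_full (inducedFunctor G) (fun X ↦ ?_) F
  obtain ⟨J, _, _, ⟨hX⟩⟩ := hG.exists_colimitsOfShape X
  refine ⟨J, inferInstance, hX.toColimitPresentation, fun j ↦ ?_⟩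
  obtain ⟨i, hi⟩ := (ObjectProperty.ofObj_iff _ _).1 (hX.prop_diag_obj j)
  exact ⟨i, ⟨eqToIso hi⟩⟩

lemma hasLimits_s15 : HasLimits C where
  has_limits_of_shape J _ := by
    rw [hasLimitsOfShape_iff_isLeftAdjoint_const]
    exact isLeftAdjoint_of_preservesColimits _

end LocallyPresentable

lemma exists_step_factorization {C : Type u} [Category.{v} C] {K : Type*} [LinearOrder K]
    {V U : C} (q : V ⟶ U) (k : K) :
    ∃ (D : K ⥤ C) (a : (Functor.const K).obj V ⟶ D) (b : D ⟶ (Functor.const K).obj U),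
      (∀ α, a.app α ≫ b.app α = q) ∧ (∀ α, α < k → IsIso (a.app α)) ∧
        ∀ α, k ≤ α → IsIso (b.app α) := by
  let φ : K →o Fin 2 := ⟨fun α ↦ if k ≤ α then 1 else 0, fun α β h ↦ by
    dsimp only
    split_ifs with h₁ h₂
    · rfl
    · exact (h₂ (h₁.trans h)).elim
    · exact Fin.zero_le _
    · rfl⟩
  let T : Fin 2 ⥤ C := ComposableArrows.mk₁ q
  refine ⟨φ.monotone.functor ⋙ T,
    { app := fun α ↦ T.map (homOfLE (Fin.zero_le (φ α)))
      naturality := fun _ _ e ↦ ?_ },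
    { app := fun α ↦ T.map (homOfLE (Fin.le_last (φ α)))
      naturality := fun _ _ e ↦ ?_ }, fun α ↦ ?_, fun α hα ↦ ?_, fun α hα ↦ ?_⟩
  · exact (Category.id_comp _).trans (T.map_comp _ (φ.monotone.functor.map e))
  · exact (T.map_comp (φ.monotone.functor.map e) _).symm.trans (Category.comp_id _).symm
  · exact (T.map_comp (homOfLE (Fin.zero_le (φ α))) (homOfLE (Fin.le_last (φ α)))).symm
  · have h : φ α = 0 := if_neg hα.not_ge
    have : IsIso (homOfLE (Fin.zero_le (φ α))) := ⟨homOfLE h.le, rfl, rfl⟩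
    exact inferInstanceAs (IsIso (T.map (homOfLE _)))
  · have h : φ α = 1 := if_pos hα
    have : IsIso (homOfLE (Fin.le_last (φ α))) := ⟨homOfLE h.ge, rfl, rfl⟩
    exact inferInstanceAs (IsIso (T.map (homOfLE _)))

lemma rlp_app_comp_of_isColimit {C : Type u} [Category.{v} C] {W : MorphismProperty C}
    {κ : Cardinal.{v}} [Fact κ.IsRegular]
    (hW : ∀ ⦃A B : C⦄ (f : A ⟶ B), W f → IsCardinalPresentable A κ ∧ IsCardinalPresentable B κ)
    {J : Type v} [SmallCategory J] [CategoryTheory.IsCardinalFiltered J κ]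
    {F : J ⥤ C} {c : Cocone F} (hc : IsColimit c) {X : C} (b : (Functor.const J).obj X ⟶ F)
    (hb : ∀ j, rlp W (b.app j)) (j : J) :
    rlp W (b.app j ≫ c.ι.app j) := by
  intro A B f hf
  obtain ⟨_, _⟩ := hW f hf
  refine ⟨fun {x y} sq ↦ ?_⟩
  obtain ⟨j₁, y', rfl⟩ := IsCardinalPresentable.exists_hom_of_isColimit κ hc y
  obtain ⟨j₂, u, w, h⟩ := IsCardinalPresentable.exists_eq_of_isColimit κ hc
    (x ≫ b.app j) (f ≫ y') (by simpa using sq.w)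
  have hu : b.app j ≫ F.map u = b.app j₂ := by simpa using (b.naturality u).symm
  have := hb j₂ f hf
  have sq' : CommSq x f (b.app j₂) (y' ≫ F.map w) := ⟨by simpa [hu] using h⟩
  refine ⟨⟨{ l := sq'.lift, fac_left := sq'.fac_left, fac_right := ?_ }⟩⟩
  have h' : sq'.lift ≫ b.app j₂ = y' ≫ F.map w := sq'.fac_right
  rw [← c.w u, reassoc_of% hu, reassoc_of% h', c.w]

lemma rlp_pi_map {C : Type u} [Category.{v} C] {W : MorphismProperty C} {K : Type*}
    {X Y : K → C} [HasProduct X] [HasProduct Y] (f : ∀ k, X k ⟶ Y k) (hf : ∀ k, rlp W (f k)) :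
    rlp W (Limits.Pi.map f) := by
  intro A B i hi
  have (k : K) := hf k i hi
  refine ⟨fun {x y} sq ↦ ?_⟩
  have sq' (k : K) : CommSq (x ≫ Pi.π X k) i (f k) (y ≫ Pi.π Y k) :=
    ⟨by simp [← sq.w_assoc]⟩
  exact ⟨⟨{ l := Pi.lift fun k ↦ (sq' k).lift }⟩⟩

lemma exists_lift_of_comp_eq {C : Type u} [Category.{v} C] [HasLimits C] [HasColimits C]
    {W : MorphismProperty C} {κ : Cardinal.{v}} [Fact κ.IsRegular]
    (hW : ∀ ⦃A B : C⦄ (f : A ⟶ B), W f → IsCardinalPresentable A κ ∧ IsCardinalPresentable B κ)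
    (h₀ : ∀ X : C, llp (rlp W) (initial.to X)) {V U P Q : C} {q : V ⟶ U} (hq : rlp W q)
    [IsCardinalPresentable P κ] (u : P ⟶ Q) (f₀ : Q ⟶ V) (g : Q ⟶ U) (h : u ≫ g = u ≫ f₀ ≫ q) :
    ∃ f : Q ⟶ V, f ≫ q = g ∧ u ≫ f = u ≫ f₀ := by
  have hκ : Cardinal.aleph0 ≤ κ := (Fact.out : κ.IsRegular).aleph0_le
  let K : Type v := κ.ord.ToType
  have : CategoryTheory.IsCardinalFiltered K κ :=
    inferInstanceAs (CategoryTheory.IsCardinalFiltered κ.ord.ToType κ)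
  have : NoMaxOrder K := Cardinal.noMaxOrder hκ
  have : IsFiltered K := isFiltered_of_isCardinalFiltered K κ
  choose D a b hab ha hb using fun k : K ↦ exists_step_factorization q k
  let F : K ⥤ C :=
    { obj := fun α ↦ ∏ᶜ fun k ↦ (D k).obj α
      map := fun e ↦ Limits.Pi.map fun k ↦ (D k).map e }
  let a' (α : K) : (∏ᶜ fun _ : K ↦ V) ⟶ F.obj α := Limits.Pi.map fun k ↦ (a k).app α
  have ha₁ {α β : K} (e : α ⟶ β) : a' α ≫ F.map e = a' β := by
    refine Pi.hom_ext _ _ fun k ↦ ?_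
    have h := (a k).naturality e
    simp only [Functor.const_obj_obj, Functor.const_obj_map, Category.id_comp] at h
    simp [F, a', h]
  let b' (i : K) : F ⟶ (Functor.const K).obj U :=
    { app := fun α ↦ Pi.π _ i ≫ (b i).app α
      naturality := fun α β e ↦ by simp [F] }
  have ha' (α : K) : rlp W (a' α) := by
    refine rlp_pi_map (fun k ↦ (a k).app α) fun k ↦ ?_
    rcases lt_or_ge α k with hk | hk
    · have := ha k α hk
      exact fun _ _ _ _ ↦ inferInstance
    · have := hb k α hk
      rw [show (a k).app α = q ≫ inv ((b k).app α) by simp [← hab k α]]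
      intro A B f hf
      have := hq f hf
      infer_instance
  have : Nonempty K := IsFiltered.nonempty
  let i₀ : K := Classical.arbitrary K
  let t : (∏ᶜ fun _ : K ↦ V) ⟶ colimit F := a' i₀ ≫ colimit.ι F i₀
  have ht : rlp W t := rlp_app_comp_of_isColimit hW (colimit.isColimit F)
    (b := { app := a', naturality := fun _ _ e ↦ (Category.id_comp _).trans (ha₁ e).symm }) ha' i₀
  have ht' (α : K) : a' α ≫ colimit.ι F α = t := by
    simp only [t, ← colimit.w F (IsFiltered.leftToMax α i₀),
      ← colimit.w F (IsFiltered.rightToMax α i₀), reassoc_of% ha₁]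
  let δ : Q ⟶ ∏ᶜ fun _ : K ↦ V := Pi.lift fun _ ↦ f₀
  let s (i : K) : Q ⟶ F.obj i :=
    Pi.lift (Function.update (fun k ↦ f₀ ≫ (a k).app i) i
      (have := hb i i le_rfl; g ≫ inv ((b i).app i)))
  have hs (i : K) : u ≫ s i = u ≫ δ ≫ a' i := by
    refine Pi.hom_ext _ _ fun k ↦ ?_
    by_cases hk : k = i
    · subst hk
      have := hb k k le_rfl
      simp [s, δ, a', ← cancel_mono ((b k).app k), h, hab]
    · simp [s, δ, a', hk]
  have hs' (i : K) : s i ≫ (b' i).app i = g := by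
    have := hb i i le_rfl
    simp [s, b']
  let m : widePushout P (fun _ : K ↦ Q) (fun _ ↦ u) ⟶ colimit F :=
    WidePushout.desc (u ≫ δ ≫ t) (fun i ↦ s i ≫ colimit.ι F i) fun i ↦ by
      rw [reassoc_of% hs i, ht']
  have := h₀ (widePushout P (fun _ : K ↦ Q) (fun _ ↦ u)) t ht
  have sq : CommSq (initial.to _) (initial.to _) t m := ⟨initial.hom_ext _ _⟩
  let l := sq.lift
  have hl : l ≫ t = m := sq.fac_right
  obtain ⟨α, e, he⟩ := IsCardinalPresentable.exists_eq_of_isColimit' κ (colimit.isColimit F)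
    ((WidePushout.head (fun _ : K ↦ u) ≫ l) ≫ a' i₀) ((u ≫ δ) ≫ a' i₀) (by
      have : (WidePushout.head (fun _ : K ↦ u) ≫ l) ≫ t = (u ≫ δ) ≫ t := by
        rw [Category.assoc, Category.assoc, hl, WidePushout.head_desc]
      exact (Category.assoc _ _ _).trans (this.trans (Category.assoc _ _ _).symm))
  obtain ⟨i, hi⟩ := exists_gt α
  refine ⟨WidePushout.ι (fun _ : K ↦ u) i ≫ l ≫ Pi.π _ i, ?_, ?_⟩
  · have h₁ : Pi.π (fun _ : K ↦ V) i ≫ q = t ≫ colimit.desc F ⟨U, b' i⟩ := by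
      simp [t, a', b', hab]
    rw [Category.assoc, Category.assoc, h₁, reassoc_of% hl, WidePushout.ι_desc_assoc,
      Category.assoc, colimit.ι_desc, hs']
  · have := ha i α hi
    simp only [Category.assoc, ha₁] at he
    rw [WidePushout.arrow_ι_assoc (fun _ : K ↦ u), ← cancel_mono ((a i).app α)]
    simpa [a', δ] using he =≫ Pi.π _ i

lemma exists_lift_of_comp_eq_of_small {C : Type u} [Category.{v} C] [LocallyPresentable C]
    {S : Set (Arrow C)} [Small.{v} S] (h₀ : ∀ X : C, llp (rlp (ofArrows S)) (initial.to X))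
    {V U P Q : C} {q : V ⟶ U} (hq : rlp (ofArrows S) q)
    (u : P ⟶ Q) (f₀ : Q ⟶ V) (g : Q ⟶ U) (h : u ≫ g = u ≫ f₀ ≫ q) :
    ∃ f : Q ⟶ V, f ≫ q = g ∧ u ≫ f = u ≫ f₀ := by
  have := LocallyPresentable.hasLimits_s15 (C := C)
  obtain ⟨κ, _, hκ⟩ := LocallyPresentable.exists_isCardinalPresentable_forall
    (Sum.elim (fun _ : PUnit.{v + 1} ↦ P)
      (Sum.elim (fun s : Shrink.{v} S ↦ ((equivShrink S).symm s).1.left)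
        (fun s : Shrink.{v} S ↦ ((equivShrink S).symm s).1.right)))
  have : IsCardinalPresentable P κ := hκ (.inl ⟨⟩)
  refine exists_lift_of_comp_eq (κ := κ) (fun A B f hf ↦ ⟨?_, ?_⟩) h₀ hq u f₀ g h
  · simpa using hκ (.inr (.inl (equivShrink S ⟨_, hf⟩)))
  · simpa using hκ (.inr (.inr (equivShrink S ⟨_, hf⟩)))

namespace Cylinder

variable {C : Type u} [Category.{v} C] [LocallyPresentable C]

lemma IsRightDefRetract.of_isPullback {L R : MorphismProperty C} (hW : IsCofGenWFS L R)
    {E : Cylinder C} [PreservesColimits E.I] {A B X Y : C} {j : A ⟶ X} {a : A ⟶ B}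
    {p : X ⟶ Y} {i : B ⟶ Y} (sq : IsPullback j a p i)
    (hp : ∀ ⦃K M : C⦄ (f : K ⟶ M), L f → HasLiftingProperty (E.box0 f) p)
    (hi : E.IsRightDefRetract i) : E.IsRightDefRetract j := by
  have d0_naturality'_assoc {K M T : C} (f : K ⟶ M) (g : E.I.obj M ⟶ T) :
      f ≫ E.d0.app M ≫ g = E.d0.app K ≫ E.I.map f ≫ g := by
    simp only [← Category.assoc, E.d0_naturality']
  have d1_naturality'_assoc {K M T : C} (f : K ⟶ M) (g : E.I.obj M ⟶ T) :
      f ≫ E.d1.app M ≫ g = E.d1.app K ≫ E.I.map f ≫ g := by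
    simp only [← Category.assoc, E.d1_naturality']
  have := LocallyPresentable.hasLimits_s15 (C := C)
  obtain ⟨S, _, hS⟩ := hW.exists_generating_set
  obtain ⟨r, h, hir, h₀, h₁, hσ⟩ := hi
  have : E.I.IsLeftAdjoint := LocallyPresentable.isLeftAdjoint_of_preservesColimits _
  let G := E.I.rightAdjoint
  let adj : E.I ⊣ G := Adjunction.ofIsLeftAdjoint E.I
  let ev (Z : C) : G.obj Z ⟶ Z := E.d0.app (G.obj Z) ≫ adj.counit.app Z
  have hev {T Z : C} (f : T ⟶ G.obj Z) : f ≫ ev Z = E.d0.app T ≫ (adj.homEquiv _ _).symm f := by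
    simp only [ev, adj.homEquiv_counit, ← Category.assoc, E.d0_naturality']
  obtain ⟨Z, π₁, π₂, hZ⟩ : ∃ (Z : C) (π₁ : Z ⟶ X) (π₂ : Z ⟶ G.obj Y), IsPullback π₁ π₂ p (ev Y) :=
    ⟨_, _, _, IsPullback.of_hasPullback _ _⟩
  obtain ⟨q, hq₁, hq₂⟩ : ∃ q : G.obj X ⟶ Z, q ≫ π₁ = ev X ∧ q ≫ π₂ = G.map p := by
    refine ⟨hZ.lift (ev X) (G.map p) ?_, hZ.lift_fst _ _ _, hZ.lift_snd _ _ _⟩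
    rw [hev, adj.homEquiv_counit, Category.assoc, adj.counit_naturality p]
  have hq : rlp L q := by
    intro K M f hf
    have := hp f hf
    refine ⟨fun {x y} sq' ↦ ?_⟩
    have w₁ : x ≫ ev X = f ≫ y ≫ π₁ := by rw [← hq₁, sq'.w_assoc]
    have w₂ : x ≫ G.map p = f ≫ y ≫ π₂ := by rw [← hq₂, sq'.w_assoc]
    have b₁ : pushout.inl f (E.d0.app K) ≫ E.box0 f = E.d0.app M := pushout.inl_desc _ _ _
    have b₂ : pushout.inr f (E.d0.app K) ≫ E.box0 f = E.I.map f := pushout.inr_desc _ _ _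
    obtain ⟨t, t₁, t₂⟩ : ∃ t : pushout f (E.d0.app K) ⟶ X,
        pushout.inl f (E.d0.app K) ≫ t = y ≫ π₁ ∧
          pushout.inr f (E.d0.app K) ≫ t = (adj.homEquiv _ _).symm x :=
      ⟨pushout.desc _ _ (by rw [← hev, w₁]), pushout.inl_desc _ _ _, pushout.inr_desc _ _ _⟩
    have sq'' : CommSq t (E.box0 f) p ((adj.homEquiv _ _).symm (y ≫ π₂)) := ⟨by
      apply pushout.hom_ext
      · rw [reassoc_of% t₁, reassoc_of% b₁, ← hev, Category.assoc, hZ.w]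
      · rw [reassoc_of% t₂, reassoc_of% b₂, ← adj.homEquiv_naturality_left_symm,
          ← adj.homEquiv_naturality_right_symm, w₂]⟩
    have l₁ : E.d0.app M ≫ sq''.lift = y ≫ π₁ := by
      rw [← b₁, Category.assoc, sq''.fac_left, t₁]
    have l₂ : E.I.map f ≫ sq''.lift = (adj.homEquiv _ _).symm x := by
      rw [← b₂, Category.assoc, sq''.fac_left, t₂]
    refine ⟨⟨{ l := adj.homEquiv _ _ sq''.lift, fac_left := ?_, fac_right := hZ.hom_ext ?_ ?_ }⟩⟩
    · rw [← adj.homEquiv_naturality_left, l₂, Equiv.apply_symm_apply]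
    · rw [Category.assoc, hq₁, hev, Equiv.symm_apply_apply, l₁]
    · rw [Category.assoc, hq₂, ← adj.homEquiv_naturality_right, sq''.fac_right,
        Equiv.apply_symm_apply]
  obtain ⟨g, hg₁, hg₂⟩ : ∃ g : X ⟶ Z,
      g ≫ π₁ = 𝟙 X ∧ g ≫ π₂ = adj.homEquiv _ _ (E.I.map p ≫ h) := by
    refine ⟨hZ.lift _ _ ?_, hZ.lift_fst _ _ _, hZ.lift_snd _ _ _⟩
    rw [hev, Equiv.symm_apply_apply, ← d0_naturality'_assoc, h₀, Category.id_comp,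
      Category.comp_id]
  have hj₀ : j ≫ g = j ≫ adj.homEquiv X X (E.σ.app X) ≫ q := by
    have σ_naturality {K M : C} (f : K ⟶ M) : E.I.map f ≫ E.σ.app M = E.σ.app K ≫ f :=
      E.σ.naturality f
    refine hZ.hom_ext ?_ ?_
    · simp only [Category.assoc, hg₁, hq₁, hev, Equiv.symm_apply_apply, E.d0_σ]
    · simp only [Category.assoc, hg₂, hq₂, ← adj.homEquiv_naturality_left,
        ← adj.homEquiv_naturality_right]
      rw [← E.I.map_comp_assoc, sq.w, E.I.map_comp_assoc, hσ, reassoc_of% (σ_naturality j), sq.w,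
        ← reassoc_of% (σ_naturality a)]
  obtain ⟨f, hf₁, hf₂⟩ := exists_lift_of_comp_eq_of_small (S := S) (fun Z ↦ hS ▸ hW.initial_mem Z)
    (fun K M k hk ↦ hq k (hS ▸ fun _ _ g hg ↦ hg k hk)) j (adj.homEquiv X X (E.σ.app X)) g hj₀
  let h' : E.I.obj X ⟶ X := (adj.homEquiv _ _).symm f
  have h'₀ : E.d0.app X ≫ h' = 𝟙 X := by
    rw [← hev, ← hq₁, reassoc_of% hf₁, hg₁]
  have h'σ : E.I.map j ≫ h' = E.σ.app A ≫ j := by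
    rw [← adj.homEquiv_naturality_left_symm, hf₂, adj.homEquiv_naturality_left_symm]
    simp
  have h'p : h' ≫ p = E.I.map p ≫ h := by
    rw [← adj.homEquiv_naturality_right_symm, Equiv.symm_apply_eq]
    rw [← hq₂, reassoc_of% hf₁, hg₂]
  have h'₁ : (E.d1.app X ≫ h') ≫ p = (p ≫ r) ≫ i := by
    rw [Category.assoc, h'p, ← d1_naturality'_assoc, h₁, Category.assoc]
  have hj : j ≫ E.d1.app X ≫ h' = j := by
    rw [d1_naturality'_assoc, h'σ, reassoc_of% E.d1_σ A]
  refine ⟨sq.lift _ _ h'₁, h', sq.hom_ext ?_ ?_, h'₀, (sq.lift_fst _ _ _).symm, h'σ⟩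
  · simp [hj]
  · simp [sq.w_assoc, hir]

/-- The cylinder obtained by exchanging the two ends of `E`. -/
def swap {C : Type u} [Category.{v} C] (E : Cylinder C) : Cylinder C where
  I := E.I
  d0 := E.d1
  d1 := E.d0
  σ := E.σ
  d0_σ := E.d1_σ
  d1_σ := E.d0_σ

end Cylinder

/-- Proposition 3.13 (leftright): pulling back a right deformation retract along a left
`I`-fibration yields a right deformation retract, and dually. -/
theorem statement_15    {C : Type u} [Category.{v} C] [LocallyPresentable C]
    (L R : MorphismProperty C) (hW : IsCofGenWFS L R)
    (E : Cylinder C) (hE : IsExactCylinder E L)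
    (An : MorphismProperty C) (hAn : IsRightAnodyneClass E L An)
    (Anl : MorphismProperty C) (hAnl : IsLeftAnodyneClass E L Anl)
    ⦃A B X Y : C⦄ (j : A ⟶ X) (a : A ⟶ B) (p : X ⟶ Y) (i : B ⟶ Y)
    (sq : IsPullback j a p i) :
    (E.IsRightDefRetract i → IsFib Anl p → E.IsRightDefRetract j) ∧
    (E.IsLeftDefRetract i → IsFib An p → E.IsLeftDefRetract j) := by
  have := hE.preservesColimits
  refine ⟨fun hi hp ↦ hi.of_isPullback hW sq fun _ _ f hf ↦ hp _ (hAnl.box0_mem f hf),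
    fun hi hp ↦ ?_⟩
  have : PreservesColimits E.swap.I := this
  exact Cylinder.IsRightDefRetract.of_isPullback (E := E.swap) hW sq
    (fun _ _ f hf ↦ hp _ (hAn.box1_mem f hf)) hi

end Paper
end
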